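/- Fix a field K. Let A, B, C be graded Lie algebras over K with injective graded homomorphisms g0 : B → A and g1 : B → C. Then there exist a graded Lie algebra D over K and injective graded homomorphisms f0 : A → D and f1 : C → D with f0 ∘ g0 = f1 ∘ g1, such that f0(A) ∩ f1(C) = f0(g0(B)), D is generated as a Lie algebra by f0(A) ∪ f1(C), and for every graded Lie algebra E over K and all graded homomorphisms f : A → E and g : C → E with f ∘ g0 = g ∘ g1, there is a graded homomorphism h : D → E with h ∘ f0 = f and h ∘ f1 = g. That is, the class of all graded Lie algebras over a given field K is closed under free amalgamation. -/

import Mathlib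

universe u

/-- A graded Lie algebra over `K`: a Lie algebra together with submodules `piece i`,
`i ≥ 1`, such that the algebra is their internal direct sum (`piece 0 = ⊥`) and
`⁅piece i, piece j⁆ ⊆ piece (i + j)`. -/
structure GradedLieAlg (K : Type u) [Field K] where
  carrier : Type u
  [lieRing : LieRing carrier]
  [lieAlgebra : LieAlgebra K carrier]
  piece : ℕ → Submodule K carrier
  isInternal : DirectSum.IsInternal piece
  piece_zero : piece 0 = ⊥
  lie_mem : ∀ i j (x y : carrier), x ∈ piece i → y ∈ piece j → ⁅x, y⁆ ∈ piece (i + j)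

attribute [instance] GradedLieAlg.lieRing GradedLieAlg.lieAlgebra

instance (K : Type u) [Field K] : CoeSort (GradedLieAlg K) (Type u) :=
  ⟨GradedLieAlg.carrier⟩

/-- A Lie algebra homomorphism between graded Lie algebras is graded if it maps the
`i`-th component into the `i`-th component for every `i`. -/
def LieHomIsGraded {K : Type u} [Field K] (A B : GradedLieAlg K)
    (f : A →ₗ⁅K⁆ B) : Prop :=
  ∀ i (x : A), x ∈ A.piece i → f x ∈ B.piece i

namespace FreeAmalg

section PBW

variable {K : Type u} [Field K] {I : Type u}

open Classical in
noncomputable def inv (r : I → I → Prop) : List I → ℕ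
  | [] => 0
  | p :: w => w.countP (fun q => decide (r p q)) + inv r w

theorem inv_lt (r : I → I → Prop) (u v : List I) (p q : I) (h : r p q) (h' : ¬ r q p) :
    inv r (u ++ q :: p :: v) < inv r (u ++ p :: q :: v) := by
  induction u with
  | nil => simp [inv, h, h']; omega
  | cons a u ih =>
    simp only [List.cons_append, inv]
    have : List.countP (fun s => @decide (r a s) (Classical.propDecidable _)) (u ++ q :: p :: v)
        = List.countP (fun s => @decide (r a s) (Classical.propDecidable _)) (u ++ p :: q :: v) := by
      apply List.Perm.countP_eq
      exact List.Perm.append_left _ (List.Perm.swap _ _ _)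
    omega

def HasDesc (r : I → I → Prop) (w : List I) : Prop :=
  ∃ d : List I × I × I × List I, w = d.1 ++ d.2.1 :: d.2.2.1 :: d.2.2.2 ∧ r d.2.1 d.2.2.1

open Classical in
noncomputable def sig (r : I → I → Prop) (hr : ∀ p q, r p q → ¬ r q p)
    (c : I → I → (I →₀ K)) (w : List I) : List I →₀ K :=
  if h : HasDesc r w then
    sig r hr c (h.choose.1 ++ h.choose.2.2.1 :: h.choose.2.1 :: h.choose.2.2.2) +
      ∑ t ∈ (c h.choose.2.1 h.choose.2.2.1).support,
        c h.choose.2.1 h.choose.2.2.1 t • sig r hr c (h.choose.1 ++ t :: h.choose.2.2.2)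
  else Finsupp.single w 1
termination_by (w.length, inv r w)
decreasing_by
  · have h1 := h.choose_spec
    have h2 := inv_lt r h.choose.1 h.choose.2.2.2 _ _ h1.2 (hr _ _ h1.2)
    rw [← h1.1] at h2
    have h3 := congrArg List.length h1.1
    refine Prod.Lex.right' _ ?_ h2
    simp only [List.length_append, List.length_cons] at h3 ⊢
    omega
  · have h1 := h.choose_spec
    have h3 := congrArg List.length h1.1
    refine Prod.Lex.left _ _ ?_
    simp only [List.length_append, List.length_cons] at h3 ⊢
    omega

variable (r : I → I → Prop) (hr : ∀ p q, r p q → ¬ r q p)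

noncomputable def T (c : I → I → (I →₀ K)) (u v : List I) : (I →₀ K) →ₗ[K] (List I →₀ K) :=
  Finsupp.linearCombination K (fun t => sig r hr c (u ++ t :: v))

theorem T_single (c : I → I → (I →₀ K)) (u v : List I) (t : I) :
    T r hr c u v (Finsupp.single t 1) = sig r hr c (u ++ t :: v) := by
  simp [T]

def Good (c : I → I → (I →₀ K)) (w : List I) : Prop :=
  ∀ u p q v, w = u ++ p :: q :: v → r p q →
    sig r hr c (u ++ p :: q :: v) = sig r hr c (u ++ q :: p :: v) + T r hr c u v (c p q)

theorem sig_desc (c : I → I → (I →₀ K)) (w : List I) (h : HasDesc r w) :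
    ∃ u p q v, w = u ++ p :: q :: v ∧ r p q ∧
      sig r hr c w = sig r hr c (u ++ q :: p :: v) + T r hr c u v (c p q) := by
  refine ⟨h.choose.1, h.choose.2.1, h.choose.2.2.1, h.choose.2.2.2, h.choose_spec.1,
    h.choose_spec.2, ?_⟩
  rw [sig, dif_pos h]
  rfl

theorem sig_normal (c : I → I → (I →₀ K)) (w : List I) (h : ¬ HasDesc r w) :
    sig r hr c w = Finsupp.single w 1 := by
  rw [sig, dif_neg h]

theorem sig_letter (c : I → I → (I →₀ K)) (p : I) :
    sig r hr c [p] = Finsupp.single [p] 1 := by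
  apply sig_normal
  rintro ⟨d, h, -⟩
  have := congrArg List.length h
  simp only [List.length_append, List.length_cons, List.length_nil] at this
  omega

/-- disjoint overlap -/
theorem conf_disj (c : I → I → (I →₀ K)) (u a v : List I) (p q p' q' : I)
    (h : r p q) (h' : r p' q')
    (hlen : ∀ w : List I, w.length < (u ++ p :: q :: a ++ p' :: q' :: v).length → Good r hr c w)
    (hinv : ∀ w : List I, w.length = (u ++ p :: q :: a ++ p' :: q' :: v).length →
      inv r w < inv r (u ++ p :: q :: a ++ p' :: q' :: v) → Good r hr c w) :
    sig r hr c (u ++ q :: p :: (a ++ p' :: q' :: v)) + T r hr c u (a ++ p' :: q' :: v) (c p q) =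
    sig r hr c ((u ++ p :: q :: a) ++ q' :: p' :: v) + T r hr c (u ++ p :: q :: a) v (c p' q') := by
  have e1 : sig r hr c (u ++ q :: p :: (a ++ p' :: q' :: v)) =
      sig r hr c ((u ++ q :: p :: a) ++ q' :: p' :: v)
        + T r hr c (u ++ q :: p :: a) v (c p' q') := by
    have := hinv ((u ++ q :: p :: a) ++ p' :: q' :: v) (by simp) (by
      have := inv_lt r u (a ++ p' :: q' :: v) p q h (hr _ _ h)
      simpa using this) (u ++ q :: p :: a) p' q' v rfl h'
    rw [← this]; simp
  have e2 : sig r hr c ((u ++ p :: q :: a) ++ q' :: p' :: v) =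
      sig r hr c ((u ++ q :: p :: a) ++ q' :: p' :: v)
        + T r hr c u (a ++ q' :: p' :: v) (c p q) := by
    have := hinv (u ++ p :: q :: (a ++ q' :: p' :: v)) (by simp) (by
      have := inv_lt r (u ++ p :: q :: a) v p' q' h' (hr _ _ h')
      simpa using this) u p q (a ++ q' :: p' :: v) rfl h
    simpa using this
  have e3 : T r hr c u (a ++ p' :: q' :: v) (c p q) = T r hr c u (a ++ q' :: p' :: v) (c p q)
      + (c p q).sum fun t x => x • T r hr c (u ++ t :: a) v (c p' q') := by
    simp only [T, Finsupp.linearCombination_apply]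
    rw [← Finsupp.sum_add]
    refine Finsupp.sum_congr fun t _ => ?_
    rw [← smul_add]
    congr 1
    have := hlen ((u ++ t :: a) ++ p' :: q' :: v) (by simp) (u ++ t :: a) p' q' v rfl h'
    simpa [T, Finsupp.linearCombination_apply] using this
  have e4 : T r hr c (u ++ p :: q :: a) v (c p' q') = T r hr c (u ++ q :: p :: a) v (c p' q')
      + (c p' q').sum fun t x => x • T r hr c u (a ++ t :: v) (c p q) := by
    simp only [T, Finsupp.linearCombination_apply]
    rw [← Finsupp.sum_add]
    refine Finsupp.sum_congr fun t _ => ?_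
    rw [← smul_add]
    congr 1
    have := hlen (u ++ p :: q :: (a ++ t :: v)) (by simp) u p q (a ++ t :: v) rfl h
    simpa [T, Finsupp.linearCombination_apply] using this
  have e5 : ((c p q).sum fun t x => x • T r hr c (u ++ t :: a) v (c p' q')) =
      (c p' q').sum fun t x => x • T r hr c u (a ++ t :: v) (c p q) := by
    simp only [T, Finsupp.linearCombination_apply, Finsupp.smul_sum]
    rw [Finsupp.sum_comm]
    refine Finsupp.sum_congr fun t _ => Finsupp.sum_congr fun s _ => ?_
    rw [smul_comm]
    simp
  rw [e1, e2, e3, e4, e5]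
  abel

variable (β : (I →₀ K) →ₗ[K] (I →₀ K) →ₗ[K] (I →₀ K))

/-- structure constants -/
noncomputable def cc : I → I → (I →₀ K) := fun p q => β (Finsupp.single p 1) (Finsupp.single q 1)

theorem comm_letter {S : Set I}
    (htot : ∀ p ∈ S, ∀ q ∈ S, p = q ∨ r p q ∨ r q p)
    (hself : ∀ p ∈ S, cc β p p = 0)
    (hskew : ∀ p ∈ S, ∀ q ∈ S, cc β p q = - cc β q p)
    (n : ℕ) (hlen : ∀ w : List I, w.length < n → Good r hr (cc β) w)
    (u v : List I) (hn : u.length + v.length + 2 < n) (q : I) (hq : q ∈ S) (x : I →₀ K)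
    (hx : x ∈ Finsupp.supported K K S) :
    T r hr (cc β) (u ++ [q]) v x - T r hr (cc β) u (q :: v) x =
      T r hr (cc β) u v (β (Finsupp.single q 1) x) := by
  rw [Finsupp.supported_eq_span_single] at hx
  induction hx using Submodule.span_induction with
  | mem x hx =>
    obtain ⟨t, ht, rfl⟩ := hx
    have key : sig r hr (cc β) (u ++ q :: t :: v) = sig r hr (cc β) (u ++ t :: q :: v)
        + T r hr (cc β) u v (cc β q t) := by
      rcases htot q hq t ht with rfl | h | h
      · rw [hself _ hq]; simp
      · exact hlen _ (by simp; omega) u q t v rfl h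
      · have := hlen (u ++ t :: q :: v) (by simp; omega) u t q v rfl h
        rw [this, hskew _ hq _ ht]; simp
    rw [T_single, T_single]
    simp only [List.append_assoc, List.cons_append, List.nil_append]
    rw [key]; simp [cc]
  | zero => simp
  | add x y _ _ hx hy => simp only [map_add, ← hx, ← hy]; abel
  | smul a x _ hx => simp only [map_smul, ← hx, smul_sub]

theorem conf_over {S : Set I}
    (htot : ∀ p ∈ S, ∀ q ∈ S, p = q ∨ r p q ∨ r q p)
    (htrans : ∀ p q s, r p q → r q s → r p s)
    (hself : ∀ p ∈ S, cc β p p = 0)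
    (hskew : ∀ p ∈ S, ∀ q ∈ S, cc β p q = - cc β q p)
    (hmem : ∀ p ∈ S, ∀ q ∈ S, cc β p q ∈ Finsupp.supported K K S)
    (hjac : ∀ p ∈ S, ∀ q ∈ S, ∀ s ∈ S,
      β (Finsupp.single q 1) (cc β p s) = β (Finsupp.single p 1) (cc β q s)
        + β (Finsupp.single s 1) (cc β p q))
    (u v : List I) (p q s : I) (hp : p ∈ S) (hq : q ∈ S) (hs : s ∈ S)
    (h : r p q) (h' : r q s)
    (hlen : ∀ w : List I, w.length < (u ++ p :: q :: s :: v).length → Good r hr (cc β) w)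
    (hinv : ∀ w : List I, w.length = (u ++ p :: q :: s :: v).length →
      inv r w < inv r (u ++ p :: q :: s :: v) → Good r hr (cc β) w) :
    sig r hr (cc β) (u ++ q :: p :: s :: v) + T r hr (cc β) u (s :: v) (cc β p q) =
    sig r hr (cc β) (u ++ p :: s :: q :: v) + T r hr (cc β) (u ++ [p]) v (cc β q s) := by
  have h2 := htrans _ _ _ h h'
  have i1 := inv_lt r u (s :: v) p q h (hr _ _ h)
  have i2 := inv_lt r (u ++ [q]) v p s h2 (hr _ _ h2)
  have i3 := inv_lt r (u ++ [p]) v q s h' (hr _ _ h')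
  have i4 := inv_lt r u (q :: v) p s h2 (hr _ _ h2)
  simp only [List.append_assoc, List.cons_append, List.nil_append] at i1 i2 i3 i4
  have e1 := hinv (u ++ q :: p :: s :: v) (by simp) i1 (u ++ [q]) p s v (by simp) h2
  have e2 := hinv (u ++ q :: s :: p :: v) (by simp) (i2.trans i1) u q s (p :: v) (by simp) h'
  have e3 := hinv (u ++ p :: s :: q :: v) (by simp) i3 u p s (q :: v) (by simp) h2
  have e4 := hinv (u ++ s :: p :: q :: v) (by simp) (i4.trans i3) (u ++ [s]) p q v (by simp) h
  have hc := comm_letter r hr β htot hself hskew _ hlen u v (by simp; omega)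
  have c1 := hc q hq _ (hmem p hp s hs)
  have c2 := hc p hp _ (hmem q hq s hs)
  have c3 := hc s hs _ (hmem p hp q hq)
  simp only [List.append_assoc, List.cons_append, List.nil_append] at e1 e2 e3 e4
  rw [hjac p hp q hq s hs, map_add, ← c2, ← c3] at c1
  rw [e1, e2, e3, e4]
  rw [sub_eq_iff_eq_add] at c1
  rw [c1]
  abel

theorem all_good {J : Type*} (S : J → Set I)
    (htot : ∀ j, ∀ p ∈ S j, ∀ q ∈ S j, p = q ∨ r p q ∨ r q p)
    (htrans : ∀ p q s, r p q → r q s → r p s)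
    (hchain : ∀ p q s, r p q → r q s → ∃ j, p ∈ S j ∧ q ∈ S j ∧ s ∈ S j)
    (hself : ∀ j, ∀ p ∈ S j, cc β p p = 0)
    (hskew : ∀ j, ∀ p ∈ S j, ∀ q ∈ S j, cc β p q = - cc β q p)
    (hmem : ∀ j, ∀ p ∈ S j, ∀ q ∈ S j, cc β p q ∈ Finsupp.supported K K (S j))
    (hjac : ∀ j, ∀ p ∈ S j, ∀ q ∈ S j, ∀ s ∈ S j,
      β (Finsupp.single q 1) (cc β p s) = β (Finsupp.single p 1) (cc β q s)
        + β (Finsupp.single s 1) (cc β p q)) :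
    ∀ n m : ℕ, ∀ w : List I, w.length = n → inv r w = m → Good r hr (cc β) w := by
  intro n
  induction n using Nat.strong_induction_on with
  | _ n ihn =>
  intro m
  induction m using Nat.strong_induction_on with
  | _ m ihm =>
  intro w hwn hwm
  have hlen : ∀ w' : List I, w'.length < w.length → Good r hr (cc β) w' := fun w' h =>
    ihn _ (hwn ▸ h) _ w' rfl rfl
  have hinv : ∀ w' : List I, w'.length = w.length → inv r w' < inv r w →
      Good r hr (cc β) w' := fun w' h h' => ihm _ (hwm ▸ h') w' (h.trans hwn) rfl
  have conf : ∀ u p q v u' p' q' v', w = u ++ p :: q :: v → r p q →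
      w = u' ++ p' :: q' :: v' → r p' q' → u.length ≤ u'.length →
      sig r hr (cc β) (u ++ q :: p :: v) + T r hr (cc β) u v (cc β p q) =
      sig r hr (cc β) (u' ++ q' :: p' :: v') + T r hr (cc β) u' v' (cc β p' q') := by
    intro u p q v u' p' q' v' hw h hw' h' hle
    have hh := hw.symm.trans hw'
    rw [List.append_eq_append_iff] at hh
    have : ∃ a, u' = u ++ a ∧ p :: q :: v = a ++ p' :: q' :: v' := by
      rcases hh with hh | ⟨a, ha, hb⟩
      · exact hh
      · have : a = [] := by
          have := congrArg List.length ha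
          simp only [List.length_append] at this
          exact List.eq_nil_of_length_eq_zero (by omega)
        subst this
        exact ⟨[], by simpa using ha.symm, by simpa using hb.symm⟩
    obtain ⟨a, rfl, ha⟩ := this
    match a, ha with
    | [], ha =>
      simp only [List.nil_append, List.cons.injEq] at ha
      obtain ⟨rfl, rfl, rfl⟩ := ha
      simp
    | [x], ha =>
      simp only [List.nil_append, List.cons_append, List.cons.injEq] at ha
      obtain ⟨rfl, rfl, rfl⟩ := ha
      obtain ⟨j, hp, hq, hs⟩ := hchain _ _ _ h h'
      subst hw
      have := conf_over r hr β (htot j) htrans (hself j) (hskew j) (hmem j) (hjac j) u v' p q q'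
        hp hq hs h h' hlen hinv
      simpa using this
    | x :: y :: a, ha =>
      simp only [List.cons_append, List.cons.injEq] at ha
      obtain ⟨rfl, rfl, rfl⟩ := ha
      subst hw'
      exact conf_disj r hr (cc β) u a v' p q p' q' h h' (by simpa using hlen) (by simpa using hinv)
  intro u p q v hw h
  obtain ⟨u', p', q', v', hw', h', e⟩ := sig_desc r hr (cc β) w ⟨(u, p, q, v), hw, h⟩
  rw [← hw, e]
  rcases le_total u.length u'.length with hl | hl
  · exact (conf _ _ _ _ _ _ _ _ hw h hw' h' hl).symm
  · exact conf _ _ _ _ _ _ _ _ hw' h' hw h hl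

theorem pbw {J : Type*} (S : J → Set I)
    (htot : ∀ j, ∀ p ∈ S j, ∀ q ∈ S j, p = q ∨ r p q ∨ r q p)
    (htrans : ∀ p q s, r p q → r q s → r p s)
    (hchain : ∀ p q s, r p q → r q s → ∃ j, p ∈ S j ∧ q ∈ S j ∧ s ∈ S j)
    (hself : ∀ j, ∀ p ∈ S j, cc β p p = 0)
    (hskew : ∀ j, ∀ p ∈ S j, ∀ q ∈ S j, cc β p q = - cc β q p)
    (hmem : ∀ j, ∀ p ∈ S j, ∀ q ∈ S j, cc β p q ∈ Finsupp.supported K K (S j))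
    (hjac : ∀ j, ∀ p ∈ S j, ∀ q ∈ S j, ∀ s ∈ S j,
      β (Finsupp.single q 1) (cc β p s) = β (Finsupp.single p 1) (cc β q s)
        + β (Finsupp.single s 1) (cc β p q))
    (hr : ∀ p q, r p q → ¬ r q p) :
    ∃ (N : Type u) (_ : AddCommGroup N) (_ : Module K N) (L : (I →₀ K) →ₗ[K] Module.End K N),
      Function.Injective L ∧ ∀ j, ∀ x ∈ Finsupp.supported K K (S j),
        ∀ y ∈ Finsupp.supported K K (S j), L (β x y) = L x * L y - L y * L x := by
  have hgood : ∀ w, Good r hr (cc β) w := fun w =>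
    all_good r hr β S htot htrans hchain hself hskew hmem hjac _ _ w rfl rfl
  let g : List I → (List I → List I →₀ K) := fun v u => sig r hr (cc β) (u ++ v)
  let N : Submodule K (List I → List I →₀ K) := Submodule.span K (Set.range g)
  let P : I → Module.End K (List I → List I →₀ K) := fun p =>
    { toFun := fun f u => f (u ++ [p])
      map_add' := fun _ _ => rfl
      map_smul' := fun _ _ => rfl }
  have hP : ∀ p v, P p (g v) = g (p :: v) := by
    intro p v; funext u; simp [P, g]
  have hPN : ∀ p, ∀ x ∈ N, P p x ∈ N := by
    intro p x hx
    induction hx using Submodule.span_induction with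
    | mem x hx => 
      obtain ⟨v, rfl⟩ := hx
      rw [hP]; exact Submodule.subset_span ⟨_, rfl⟩
    | zero => simp
    | add x y _ _ hx hy => rw [map_add]; exact N.add_mem hx hy
    | smul a x _ hx => rw [map_smul]; exact N.smul_mem _ hx
  let L : (I →₀ K) →ₗ[K] Module.End K N :=
    Finsupp.linearCombination K (fun p => (P p).restrict (hPN p))
  let gN : List I → N := fun v => ⟨g v, Submodule.subset_span ⟨_, rfl⟩⟩
  have hLs : ∀ p v, L (Finsupp.single p 1) (gN v) = gN (p :: v) := by
    intro p v
    apply Subtype.ext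
    simp only [L, Finsupp.linearCombination_single, one_smul]
    exact hP p v
  have hL : ∀ x v u, (L x (gN v) : List I → List I →₀ K) u = T r hr (cc β) u v x := by
    intro x v u
    induction x using Finsupp.induction_linear with
    | zero => simp
    | add x y hx hy => simp [hx, hy]
    | single p a =>
      have : Finsupp.single p a = a • Finsupp.single p (1 : K) := by simp
      rw [this, map_smul, map_smul, LinearMap.smul_apply, hLs, T_single]
      rfl
  refine ⟨N, inferInstance, inferInstance, L, ?_, ?_⟩
  · rw [injective_iff_map_eq_zero]
    intro x hx
    have h0 := hL x [] []
    rw [hx] at h0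
    simp only [T, List.nil_append, sig_letter] at h0
    have : Finsupp.linearCombination K (fun t : I => Finsupp.single [t] (1 : K)) x
        = Finsupp.mapDomain (fun t => [t]) x := by
      simp [Finsupp.linearCombination_apply, Finsupp.mapDomain]
    rw [this] at h0
    exact Finsupp.mapDomain_injective (List.singleton_injective) (by simpa using h0.symm)
  · intro j x hx y hy
    have hc := fun u v => fun (q : I) hq => comm_letter r hr β (htot j) (hself j) (hskew j)
      (u.length + v.length + 3) (fun w _ => hgood w) u v (by omega) q hq
    rw [Finsupp.supported_eq_span_single] at hx
    induction hx using Submodule.span_induction with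
    | mem x hx =>
      obtain ⟨q, hq, rfl⟩ := hx
      have hh : ∀ v, L (β (Finsupp.single q 1) y) (gN v) =
          L (Finsupp.single q 1) (L y (gN v)) - L y (L (Finsupp.single q 1) (gN v)) := by
        intro v
        apply Subtype.ext
        funext u
        rw [hLs, hL, ← hc u v q hq y hy]
        simp only [Submodule.coe_sub, Pi.sub_apply, hL]
        congr 1
        have : ((L (Finsupp.single q 1)) ((L y) (gN v)) : List I → List I →₀ K) = P q (L y (gN v) : List I → List I →₀ K) := by
          simp only [L, Finsupp.linearCombination_single, one_smul]; rfl
        rw [this]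
        exact (hL y v (u ++ [q])).symm
      ext z : 1
      change _ = L (Finsupp.single q 1) (L y z) - L y (L (Finsupp.single q 1) z)
      obtain ⟨z, hz⟩ := z
      induction hz using Submodule.span_induction with
      | mem z hz => obtain ⟨v, rfl⟩ := hz; exact hh v
      | zero => 
        have : (⟨0, N.zero_mem⟩ : N) = 0 := rfl
        rw [this]; simp only [map_zero]; apply Subtype.ext; simp
      | add z z' h h' e e' => 
        have : (⟨z + z', N.add_mem h h'⟩ : N) = ⟨z, h⟩ + ⟨z', h'⟩ := rfl
        rw [this]; simp only [map_add, e, e']; abel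
      | smul a z h e =>
        have : (⟨a • z, N.smul_mem a h⟩ : N) = a • ⟨z, h⟩ := rfl
        rw [this]; simp only [map_smul, e]; apply Subtype.ext; simp [smul_sub]
    | zero => simp
    | add x x' _ _ e e' => 
      simp only [map_add, LinearMap.add_apply, e, e', add_mul, mul_add]; abel
    | smul a x _ e => simp only [map_smul, LinearMap.smul_apply, e, smul_mul_assoc, mul_smul_comm, smul_sub]

end PBW

section Rep

open Module

attribute [local instance 100] LieRing.ofAssociativeRing

variable {K : Type u} [Field K]

theorem exists_basis_sum {ι : Type u} {V : Type u} [AddCommGroup V] [Module K V] (v : ι → V)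
    (hv : LinearIndependent K v) :
    ∃ (X : Type u) (b : Basis (ι ⊕ X) K V), ∀ i, b (Sum.inl i) = v i := by
  refine ⟨_, Basis.sumExtend hv, fun i => ?_⟩
  simp only [Basis.sumExtend, Basis.coe_reindex, Basis.coe_extend, Function.comp_apply]
  letI := Classical.decPred (· ∈ Set.range v)
  exact congrArg Subtype.val (Equiv.Set.sumDiffSubset_apply_inl
    (hv.linearIndepOn_id.subset_extend (Set.subset_univ _)) (Equiv.ofInjective v hv.injective i))

variable {I : Type u} {A : Type u} [LieRing A] [LieAlgebra K A]

theorem facts {ι : Type u} (e : ι → I) (b : Basis ι K A) (φ : A →ₗ[K] (I →₀ K))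
    (hφ : ∀ s, φ (b s) = Finsupp.single (e s) 1)
    (β : (I →₀ K) →ₗ[K] (I →₀ K) →ₗ[K] (I →₀ K))
    (hβ : ∀ x y, β (φ x) (φ y) = φ ⁅x, y⁆) :
    (∀ x, φ x ∈ Finsupp.supported K K (Set.range e)) ∧
    (∀ p ∈ Set.range e, cc β p p = 0) ∧
    (∀ p ∈ Set.range e, ∀ q ∈ Set.range e, cc β p q = - cc β q p) ∧
    (∀ p ∈ Set.range e, ∀ q ∈ Set.range e, cc β p q ∈ Finsupp.supported K K (Set.range e)) ∧
    (∀ p ∈ Set.range e, ∀ q ∈ Set.range e, ∀ s ∈ Set.range e,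
      β (Finsupp.single q 1) (cc β p s) = β (Finsupp.single p 1) (cc β q s)
        + β (Finsupp.single s 1) (cc β p q)) := by
  have h0 : ∀ x, φ x ∈ Finsupp.supported K K (Set.range e) := by
    intro x
    have hx : x ∈ Submodule.span K (Set.range b) := by rw [b.span_eq]; trivial
    induction hx using Submodule.span_induction with
    | mem x hx =>
      obtain ⟨s, rfl⟩ := hx
      rw [hφ]
      exact Finsupp.single_mem_supported K 1 ⟨s, rfl⟩
    | zero => simp
    | add x y _ _ hx hy => rw [map_add]; exact Submodule.add_mem _ hx hy
    | smul a x _ hx => rw [map_smul]; exact Submodule.smul_mem _ _ hx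
  have hcc : ∀ s t, cc β (e s) (e t) = φ ⁅b s, b t⁆ := by
    intro s t
    rw [cc, ← hφ, ← hφ, hβ]
  refine ⟨h0, ?_, ?_, ?_, ?_⟩
  · rintro _ ⟨s, rfl⟩; rw [hcc]; simp
  · rintro _ ⟨s, rfl⟩ _ ⟨t, rfl⟩; rw [hcc, hcc, ← lie_skew, map_neg]
  · rintro _ ⟨s, rfl⟩ _ ⟨t, rfl⟩; rw [hcc]; exact h0 _
  · rintro _ ⟨s, rfl⟩ _ ⟨t, rfl⟩ _ ⟨w, rfl⟩
    rw [hcc, hcc, hcc, ← hφ, ← hφ, ← hφ, hβ, hβ, hβ, ← map_add]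
    congr 1
    rw [leibniz_lie (b t) (b s) (b w), ← lie_skew (b w) ⁅b s, b t⁆, ← lie_skew (b s) (b t),
      neg_lie, neg_neg, add_comm]

theorem bilin_ext {ι : Type u} (e : ι → I) (b : Basis ι K A) (φ : A →ₗ[K] (I →₀ K))
    (hφ : ∀ s, φ (b s) = Finsupp.single (e s) 1)
    (β : (I →₀ K) →ₗ[K] (I →₀ K) →ₗ[K] (I →₀ K))
    (h : ∀ s t, cc β (e s) (e t) = φ ⁅b s, b t⁆) (x y : A) :
    β (φ x) (φ y) = φ ⁅x, y⁆ := by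
  have : β.compl₁₂ φ φ = (LieModule.toEnd K A A : A →ₗ[K] End K A).compr₂ φ := by
    refine b.ext fun s => b.ext fun t => ?_
    have := h s t
    rw [cc, ← hφ, ← hφ] at this
    simpa using this
  have := LinearMap.congr_fun (LinearMap.congr_fun this x) y
  simpa using this

variable {B C : Type u} [LieRing B] [LieAlgebra K B] [LieRing C] [LieAlgebra K C]

def kap {X Y Z : Type u} : X ⊕ (Y ⊕ Z) → ℕ
  | Sum.inl _ => 0
  | Sum.inr (Sum.inl _) => 1
  | Sum.inr (Sum.inr _) => 2

def rel {X Y Z : Type u} (p q : X ⊕ (Y ⊕ Z)) : Prop :=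
  (kap q = 0 ∧ kap p ≠ 0) ∨ (kap p = kap q ∧ WellOrderingRel q p)

def eA {X Y Z : Type u} : X ⊕ Y → X ⊕ (Y ⊕ Z) := Sum.map id Sum.inl
def eC {X Y Z : Type u} : X ⊕ Z → X ⊕ (Y ⊕ Z) := Sum.map id Sum.inr

theorem mem_eA {X Y Z : Type u} (p : X ⊕ (Y ⊕ Z)) : p ∈ Set.range (eA (Z := Z)) ↔ kap p ≠ 2 := by
  rcases p with p | p | p <;> simp [eA, kap]

theorem mem_eC {X Y Z : Type u} (p : X ⊕ (Y ⊕ Z)) : p ∈ Set.range (eC (Y := Y)) ↔ kap p ≠ 1 := by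
  rcases p with p | p | p <;> simp [eC, kap]

theorem kap_lt {X Y Z : Type u} (p : X ⊕ (Y ⊕ Z)) : kap p < 3 := by
  rcases p with p | p | p <;> simp [kap]

theorem wtri {X : Type u} (p q : X) : p = q ∨ WellOrderingRel p q ∨ WellOrderingRel q p := by
  rcases trichotomous_of WellOrderingRel p q with h | h | h
  · exact Or.inr (Or.inl h)
  · exact Or.inl h
  · exact Or.inr (Or.inr h)

theorem rel_asymm {X Y Z : Type u} (p q : X ⊕ (Y ⊕ Z)) (h : rel p q) : ¬ rel q p := by
  rcases h with ⟨h1, h2⟩ | ⟨h1, h2⟩ <;> rintro (⟨h3, h4⟩ | ⟨h3, h4⟩)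
  · omega
  · omega
  · omega
  · exact asymm_of WellOrderingRel h2 h4

theorem rel_trans {X Y Z : Type u} (p q s : X ⊕ (Y ⊕ Z)) (h : rel p q) (h' : rel q s) :
    rel p s := by
  rcases h with ⟨h1, h2⟩ | ⟨h1, h2⟩ <;> rcases h' with ⟨h3, h4⟩ | ⟨h3, h4⟩
  · exact Or.inl ⟨by omega, by omega⟩
  · exact Or.inl ⟨by omega, by omega⟩
  · exact Or.inl ⟨by omega, by omega⟩
  · exact Or.inr ⟨by omega, trans_of WellOrderingRel h4 h2⟩

theorem rel_kap {X Y Z : Type u} (p q : X ⊕ (Y ⊕ Z)) (h : rel p q) :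
    kap q = 0 ∨ kap p = kap q := by
  rcases h with ⟨h1, h2⟩ | ⟨h1, h2⟩ <;> omega

theorem rel_tot {X Y Z : Type u} (p q : X ⊕ (Y ⊕ Z)) (h : kap p = 0 ∨ kap q = 0 ∨ kap p = kap q) :
    p = q ∨ rel p q ∨ rel q p := by
  by_cases hk : kap p = kap q
  · rcases wtri p q with h | h | h
    · exact Or.inl h
    · exact Or.inr (Or.inr (Or.inr ⟨hk.symm, h⟩))
    · exact Or.inr (Or.inl (Or.inr ⟨hk, h⟩))
  · rcases h with h | h | h
    · exact Or.inr (Or.inr (Or.inl ⟨h, by omega⟩))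
    · exact Or.inr (Or.inl (Or.inl ⟨h, by omega⟩))
    · exact absurd h hk

theorem rel_totA {X Y Z : Type u} : ∀ p ∈ Set.range (eA (X := X) (Y := Y) (Z := Z)),
    ∀ q ∈ Set.range (eA (X := X) (Y := Y) (Z := Z)), p = q ∨ rel p q ∨ rel q p := by
  intro p hp q hq
  rw [mem_eA] at hp hq
  have := kap_lt p
  have := kap_lt q
  exact rel_tot p q (by omega)

theorem rel_totC {X Y Z : Type u} : ∀ p ∈ Set.range (eC (X := X) (Y := Y) (Z := Z)),
    ∀ q ∈ Set.range (eC (X := X) (Y := Y) (Z := Z)), p = q ∨ rel p q ∨ rel q p := by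
  intro p hp q hq
  rw [mem_eC] at hp hq
  have := kap_lt p
  have := kap_lt q
  exact rel_tot p q (by omega)

theorem rel_chain {X Y Z : Type u} (p q s : X ⊕ (Y ⊕ Z)) (h : rel p q) (h' : rel q s) :
    (p ∈ Set.range (eC (Y := Y)) ∧ q ∈ Set.range (eC (Y := Y)) ∧ s ∈ Set.range (eC (Y := Y))) ∨
    (p ∈ Set.range (eA (Z := Z)) ∧ q ∈ Set.range (eA (Z := Z)) ∧ s ∈ Set.range (eA (Z := Z))) := by
  have h1 := rel_kap _ _ h
  have h2 := rel_kap _ _ h'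
  simp only [mem_eA, mem_eC]
  omega

theorem exists_rep (g0 : B →ₗ⁅K⁆ A) (g1 : B →ₗ⁅K⁆ C)
    (hg0 : Function.Injective g0) (hg1 : Function.Injective g1) :
    ∃ (N : Type u) (_ : AddCommGroup N) (_ : Module K N) (f : A →ₗ⁅K⁆ Module.End K N)
      (g : C →ₗ⁅K⁆ Module.End K N), Function.Injective f ∧ Function.Injective g ∧
      f.comp g0 = g.comp g1 ∧ ∀ a c, f a = g c → ∃ b, a = g0 b := by
  let bB := Basis.ofVectorSpace K B
  obtain ⟨XA, bA, hbA⟩ := exists_basis_sum (K := K) (fun i => g0 (bB i))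
    (bB.linearIndependent.map' (g0 : B →ₗ[K] A) (LinearMap.ker_eq_bot.mpr hg0))
  obtain ⟨XC, bC, hbC⟩ := exists_basis_sum (K := K) (fun i => g1 (bB i))
    (bB.linearIndependent.map' (g1 : B →ₗ[K] C) (LinearMap.ker_eq_bot.mpr hg1))
  let I := Basis.ofVectorSpaceIndex K B ⊕ (XA ⊕ XC)
  let φA : A →ₗ[K] (I →₀ K) := Finsupp.lmapDomain K K eA ∘ₗ bA.repr.toLinearMap
  let φC : C →ₗ[K] (I →₀ K) := Finsupp.lmapDomain K K eC ∘ₗ bC.repr.toLinearMap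
  have hφA : ∀ s, φA (bA s) = Finsupp.single (eA s) 1 := by intro s; simp [φA]
  have hφC : ∀ s, φC (bC s) = Finsupp.single (eC s) 1 := by intro s; simp [φC]
  have heA : Function.Injective (eA : _ → I) :=
    Sum.map_injective.mpr ⟨Function.injective_id, Sum.inl_injective⟩
  have heC : Function.Injective (eC : _ → I) :=
    Sum.map_injective.mpr ⟨Function.injective_id, Sum.inr_injective⟩
  have hφAi : Function.Injective φA :=
    (Finsupp.mapDomain_injective heA).comp bA.repr.injective
  have hφCi : Function.Injective φC :=
    (Finsupp.mapDomain_injective heC).comp bC.repr.injective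
  have hcomp : ∀ b, φA (g0 b) = φC (g1 b) := by
    have : φA ∘ₗ (g0 : B →ₗ[K] A) = φC ∘ₗ (g1 : B →ₗ[K] C) := by
      refine bB.ext fun i => ?_
      have h1 := hφA (Sum.inl i)
      have h2 := hφC (Sum.inl i)
      rw [hbA] at h1
      rw [hbC] at h2
      exact h1.trans h2.symm
    exact fun b => LinearMap.congr_fun this b
  let c : I → I → (I →₀ K) := fun p q =>
    match p, q with
    | Sum.inl i, Sum.inl j => φA ⁅bA (Sum.inl i), bA (Sum.inl j)⁆
    | Sum.inl i, Sum.inr (Sum.inl j) => φA ⁅bA (Sum.inl i), bA (Sum.inr j)⁆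
    | Sum.inr (Sum.inl i), Sum.inl j => φA ⁅bA (Sum.inr i), bA (Sum.inl j)⁆
    | Sum.inr (Sum.inl i), Sum.inr (Sum.inl j) => φA ⁅bA (Sum.inr i), bA (Sum.inr j)⁆
    | Sum.inl i, Sum.inr (Sum.inr j) => φC ⁅bC (Sum.inl i), bC (Sum.inr j)⁆
    | Sum.inr (Sum.inr i), Sum.inl j => φC ⁅bC (Sum.inr i), bC (Sum.inl j)⁆
    | Sum.inr (Sum.inr i), Sum.inr (Sum.inr j) => φC ⁅bC (Sum.inr i), bC (Sum.inr j)⁆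
    | _, _ => 0
  have hcA : ∀ s t, c (eA s) (eA t) = φA ⁅bA s, bA t⁆ := by
    rintro (s | s) (t | t) <;> rfl
  have hcC : ∀ s t, c (eC s) (eC t) = φC ⁅bC s, bC t⁆ := by
    rintro (s | s) (t | t)
    · change φA _ = _
      rw [hbA, hbA, hbC, hbC, ← LieHom.map_lie, ← LieHom.map_lie, hcomp]
      rfl
    all_goals rfl
  let β : (I →₀ K) →ₗ[K] (I →₀ K) →ₗ[K] (I →₀ K) :=
    Finsupp.linearCombination K (fun p => Finsupp.linearCombination K (c p))
  have hβ : ∀ p q, cc β p q = c p q := by intro p q; simp [cc, β]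
  have hβA := bilin_ext eA bA φA hφA β (fun s t => (hβ _ _).trans (hcA s t))
  have hβC := bilin_ext eC bC φC hφC β (fun s t => (hβ _ _).trans (hcC s t))
  obtain ⟨sA, a1, a2, a3, a4⟩ := facts eA bA φA hφA β hβA
  obtain ⟨sC, c1, c2, c3, c4⟩ := facts eC bC φC hφC β hβC
  let S : Bool → Set I := fun j => bif j then Set.range eA else Set.range eC
  obtain ⟨N, iN, mN, L, hL, hLc⟩ := pbw (K := K) (rel (X := Basis.ofVectorSpaceIndex K B)) β S
    (by rintro (_ | _); exacts [rel_totC, rel_totA])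
    rel_trans
    (by
      intro p q s h h'
      rcases rel_chain p q s h h' with h | h
      exacts [⟨false, h⟩, ⟨true, h⟩])
    (by rintro (_ | _); exacts [c1, a1])
    (by rintro (_ | _); exacts [c2, a2])
    (by rintro (_ | _); exacts [c3, a3])
    (by rintro (_ | _); exacts [c4, a4])
    rel_asymm
  let f : A →ₗ⁅K⁆ Module.End K N :=
    { toLinearMap := L ∘ₗ φA
      map_lie' := by
        intro x y
        have := hLc true (φA x) (sA x) (φA y) (sA y)
        rw [hβA] at this
        exact this }
  let g : C →ₗ⁅K⁆ Module.End K N :=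
    { toLinearMap := L ∘ₗ φC
      map_lie' := by
        intro x y
        have := hLc false (φC x) (sC x) (φC y) (sC y)
        rw [hβC] at this
        exact this }
  refine ⟨N, iN, mN, f, g, hL.comp hφAi, hL.comp hφCi, ?_, ?_⟩
  · ext1 b
    exact congrArg L (hcomp b)
  · intro a d h
    have h : φA a = φC d := hL h
    have hs : ∀ x, bA.repr a (Sum.inr x) = 0 := by
      intro x
      have h1 : φA a (eA (Sum.inr x)) = bA.repr a (Sum.inr x) :=
        Finsupp.mapDomain_apply heA _ _
      rw [← h1, h]
      have := sC d
      rw [Finsupp.mem_supported'] at this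
      apply this
      rw [mem_eC]
      simp [eA, kap]
    have : a ∈ LinearMap.range (g0 : B →ₗ[K] A) := by
      rw [← bA.linearCombination_repr a, Finsupp.linearCombination_apply]
      refine Submodule.sum_mem _ fun s _ => ?_
      rcases s with s | s
      · refine Submodule.smul_mem _ _ ?_
        rw [hbA]
        exact ⟨_, rfl⟩
      · change bA.repr a (Sum.inr s) • _ ∈ _
        rw [hs, zero_smul]
        exact Submodule.zero_mem _
    obtain ⟨b, hb⟩ := this
    exact ⟨b, hb.symm⟩

theorem exists_rep' (g0 : B →ₗ⁅K⁆ A) (g1 : B →ₗ⁅K⁆ C) (hg0 : Function.Injective g0)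
    (hg1 : Function.Injective g1) :
    ∃ (M : Type u) (_ : LieRing M) (_ : LieAlgebra K M) (f : A →ₗ⁅K⁆ M) (g : C →ₗ⁅K⁆ M),
      Function.Injective f ∧ Function.Injective g ∧ f.comp g0 = g.comp g1 ∧
      ∀ a c, f a = g c → ∃ b, a = g0 b := by
  obtain ⟨N, iN, mN, f, g, h⟩ := exists_rep g0 g1 hg0 hg1
  exact ⟨Module.End K N, inferInstance, inferInstance, f, g, h⟩

end Rep

section Pushout

variable {K : Type u} [Field K] {A B C : Type u} [LieRing A] [LieAlgebra K A]
  [LieRing B] [LieAlgebra K B] [LieRing C] [LieAlgebra K C]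

theorem exists_pushout (g0 : B →ₗ⁅K⁆ A) (g1 : B →ₗ⁅K⁆ C) :
    ∃ (D : Type u) (_ : LieRing D) (_ : LieAlgebra K D) (f0 : A →ₗ⁅K⁆ D) (f1 : C →ₗ⁅K⁆ D),
      f0.comp g0 = f1.comp g1 ∧
      LieSubalgebra.lieSpan K D (Set.range f0 ∪ Set.range f1) = ⊤ ∧
      ∀ (M : Type u) [LieRing M] [LieAlgebra K M] (f : A →ₗ⁅K⁆ M) (g : C →ₗ⁅K⁆ M),
        f.comp g0 = g.comp g1 → ∃ h : D →ₗ⁅K⁆ M, h.comp f0 = f ∧ h.comp f1 = g := by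
  let F := FreeLieAlgebra K (A ⊕ C)
  let a : A → F := fun x => FreeLieAlgebra.of K (Sum.inl x)
  let c : C → F := fun x => FreeLieAlgebra.of K (Sum.inr x)
  let R : Set F := {z | (∃ x y, z = a (x + y) - (a x + a y)) ∨ (∃ (k : K) (x : A), z = a (k • x) - k • a x) ∨
    (∃ x y, z = a ⁅x, y⁆ - ⁅a x, a y⁆) ∨ (∃ x y, z = c (x + y) - (c x + c y)) ∨
    (∃ (k : K) (x : C), z = c (k • x) - k • c x) ∨ (∃ x y, z = c ⁅x, y⁆ - ⁅c x, c y⁆) ∨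
    (∃ b, z = a (g0 b) - c (g1 b))}
  let J : LieIdeal K F := LieSubmodule.lieSpan K F R
  let π : F →ₗ⁅K⁆ F ⧸ J :=
    { toLinearMap := (LieSubmodule.Quotient.mk' J : F →ₗ[K] F ⧸ J)
      map_lie' := fun {x y} => LieSubmodule.Quotient.mk_bracket J x y }
  have hπ : ∀ x y, x - y ∈ R → π x = π y := by
    intro x y h
    rw [← sub_eq_zero, ← map_sub]
    exact (LieSubmodule.Quotient.mk_eq_zero J).mpr (LieSubmodule.subset_lieSpan h)
  let f0 : A →ₗ⁅K⁆ F ⧸ J :=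
    { toFun := fun x => π (a x)
      map_add' := fun x y => by
        rw [← map_add]; exact hπ _ _ (Or.inl ⟨x, y, rfl⟩)
      map_smul' := fun k x => by
        rw [RingHom.id_apply, ← map_smul]; exact hπ _ _ (Or.inr (Or.inl ⟨k, x, rfl⟩))
      map_lie' := fun {x y} => by
        rw [← LieHom.map_lie]; exact hπ _ _ (Or.inr (Or.inr (Or.inl ⟨x, y, rfl⟩))) }
  let f1 : C →ₗ⁅K⁆ F ⧸ J :=
    { toFun := fun x => π (c x)
      map_add' := fun x y => by
        rw [← map_add]; exact hπ _ _ (Or.inr (Or.inr (Or.inr (Or.inl ⟨x, y, rfl⟩))))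
      map_smul' := fun k x => by
        rw [RingHom.id_apply, ← map_smul]
        exact hπ _ _ (Or.inr (Or.inr (Or.inr (Or.inr (Or.inl ⟨k, x, rfl⟩)))))
      map_lie' := fun {x y} => by
        rw [← LieHom.map_lie]
        exact hπ _ _ (Or.inr (Or.inr (Or.inr (Or.inr (Or.inr (Or.inl ⟨x, y, rfl⟩)))))) }
  refine ⟨F ⧸ J, inferInstance, inferInstance, f0, f1, ?_, ?_, ?_⟩
  · ext1 b
    exact hπ _ _ (Or.inr (Or.inr (Or.inr (Or.inr (Or.inr (Or.inr ⟨b, rfl⟩))))))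
  · let S := LieSubalgebra.lieSpan K (F ⧸ J) (Set.range f0 ∪ Set.range f1)
    have hS : ∀ s : A ⊕ C, π (FreeLieAlgebra.of K s) ∈ S := by
      rintro (x | x)
      · exact LieSubalgebra.subset_lieSpan (Or.inl ⟨x, rfl⟩)
      · exact LieSubalgebra.subset_lieSpan (Or.inr ⟨x, rfl⟩)
    let l : F →ₗ⁅K⁆ S := FreeLieAlgebra.lift K (fun s => ⟨_, hS s⟩)
    have hl : S.incl.comp l = π := by
      apply FreeLieAlgebra.hom_ext
      intro s
      simp [l]
    rw [eq_top_iff]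
    intro z _
    obtain ⟨w, rfl⟩ := LieSubmodule.Quotient.surjective_mk' J z
    have : π w = l w := by rw [← hl]; rfl
    change π w ∈ S
    rw [this]
    exact (l w).2
  · intro M _ _ f g hfg
    let l : F →ₗ⁅K⁆ M := FreeLieAlgebra.lift K (Sum.elim f g)
    have la : ∀ x, l (a x) = f x := fun x =>
      FreeLieAlgebra.lift_of_apply (Sum.elim f g) (Sum.inl x)
    have lc : ∀ x, l (c x) = g x := fun x =>
      FreeLieAlgebra.lift_of_apply (Sum.elim f g) (Sum.inr x)
    have hJ : J ≤ l.ker := by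
      rw [LieSubmodule.lieSpan_le]
      rintro z (⟨x, y, rfl⟩ | ⟨x, y, rfl⟩ | ⟨x, y, rfl⟩ | ⟨x, y, rfl⟩ | ⟨x, y, rfl⟩ | ⟨x, y, rfl⟩ |
        ⟨x, rfl⟩)
      · simp [la]
      · simp [la]
      · simp [la]
      · simp [lc]
      · simp [lc]
      · simp [lc]
      · have := LieHom.congr_fun hfg x
        simp only [LieHom.comp_apply] at this
        simp [la, lc, this]
    let h : F ⧸ J →ₗ⁅K⁆ M :=
      { toLinearMap := Submodule.liftQ J.toSubmodule (l : F →ₗ[K] M) (fun x hx => by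
          have := hJ hx
          simpa using this)
        map_lie' := by
          intro x y
          obtain ⟨x, rfl⟩ := LieSubmodule.Quotient.surjective_mk' J x
          obtain ⟨y, rfl⟩ := LieSubmodule.Quotient.surjective_mk' J y
          exact LieHom.map_lie l x y }
    have hh : ∀ w, h (π w) = l w := fun w => rfl
    refine ⟨h, ?_, ?_⟩
    · ext1 x; exact la x
    · ext1 x; exact lc x

end Pushout

section Grade

open TensorProduct LieAlgebra

variable {K : Type u} [Field K]

theorem graded_ind (A : GradedLieAlg K) {p : A → Prop} (hom : ∀ i, ∀ x ∈ A.piece i, p x)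
    (h0 : p 0) (hadd : ∀ x y, p x → p y → p (x + y)) (x : A) : p x := by
  have hx : x ∈ ⨆ i, A.piece i := by rw [A.isInternal.submodule_iSup_eq_top]; trivial
  exact Submodule.iSup_induction A.piece (motive := p) hx hom h0 hadd

/-- The monomial `t ^ i ⊗ d`. -/
noncomputable def mono (K : Type u) [Field K] (D : Type u) [LieRing D] [LieAlgebra K D] (i : ℕ) :
    D →ₗ[K] loopAlgebra K ℕ D :=
  TensorProduct.mk K (AddMonoidAlgebra K ℕ) D (AddMonoidAlgebra.single i 1)

variable {D : Type u} [LieRing D] [LieAlgebra K D]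

theorem mono_lie (i j : ℕ) (x y : D) : ⁅mono K D i x, mono K D j y⁆ = mono K D (i + j) ⁅x, y⁆ := by
  simp [mono, AddMonoidAlgebra.single_mul_single]

theorem exists_loop (A : GradedLieAlg K) (φ : A →ₗ⁅K⁆ D) :
    ∃ δ : A →ₗ⁅K⁆ loopAlgebra K ℕ D, ∀ i, ∀ x ∈ A.piece i, δ x = mono K D i (φ x) := by
  let e := LinearEquiv.ofBijective (DirectSum.coeLinearMap A.piece) A.isInternal
  let d : A →ₗ[K] loopAlgebra K ℕ D :=
    (DirectSum.toModule K ℕ _ fun i => mono K D i ∘ₗ (φ : A →ₗ[K] D) ∘ₗ (A.piece i).subtype) ∘ₗ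
      e.symm.toLinearMap
  have hd : ∀ i, ∀ x ∈ A.piece i, d x = mono K D i (φ x) := by
    intro i x hx
    have : e.symm x = DirectSum.lof K ℕ (fun i => A.piece i) i ⟨x, hx⟩ := by
      rw [LinearEquiv.symm_apply_eq]
      exact (DirectSum.coeLinearMap_lof A.piece i ⟨x, hx⟩).symm
    simp only [d, LinearMap.comp_apply, LinearEquiv.coe_coe, this, DirectSum.toModule_lof]
    rfl
  refine ⟨{ toLinearMap := d, map_lie' := ?_ }, hd⟩
  intro x y
  change d ⁅x, y⁆ = ⁅d x, d y⁆
  induction x using graded_ind with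
  | h0 => rw [zero_lie, map_zero]; exact (zero_lie (L := loopAlgebra K ℕ D) (M := loopAlgebra K ℕ D) (d y)).symm
  | hadd x x' h h' => rw [add_lie, map_add, map_add, h, h']; exact (add_lie (L := loopAlgebra K ℕ D) (M := loopAlgebra K ℕ D) (d x) (d x') (d y)).symm
  | hom i x hx =>
    induction y using graded_ind with
    | h0 => rw [lie_zero, map_zero]; exact (lie_zero (L := loopAlgebra K ℕ D) (M := loopAlgebra K ℕ D) _).symm
    | hadd x x' h h' => rw [lie_add, map_add, map_add, h, h']; exact (lie_add (L := loopAlgebra K ℕ D) (M := loopAlgebra K ℕ D) _ _ _).symm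
    | hom j y hy =>
      rw [hd i x hx, hd j y hy, hd _ _ (A.lie_mem i j x y hx hy), mono_lie, LieHom.map_lie]

theorem mono_sum {s : Finset ℕ} {v : ℕ → D} (h : ∑ i ∈ s, mono K D i (v i) = 0) :
    ∀ i ∈ s, v i = 0 := by
  intro i hi
  have h1 := congrArg (fun z => LieAlgebra.LoopAlgebra.toFinsupp K ℕ D z i) h
  simp only [map_sum, map_zero] at h1
  have h2 : ∀ j, LieAlgebra.LoopAlgebra.toFinsupp K ℕ D (mono K D j (v j)) = Finsupp.single j (v j) :=
    fun j => LieAlgebra.LoopAlgebra.toFinsupp_single_tmul K ℕ D j (v j)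
  simp only [h2, Finsupp.finsetSum_apply, Finsupp.single_apply] at h1
  simpa [hi] using h1

theorem sup_top {A C : GradedLieAlg K} (f0 : A →ₗ⁅K⁆ D) (f1 : C →ₗ⁅K⁆ D)
    (hgen : LieSubalgebra.lieSpan K D (Set.range f0 ∪ Set.range f1) = ⊤)
    (P : ℕ → Submodule K D) (hP : ∀ i j x y, x ∈ P i → y ∈ P j → ⁅x, y⁆ ∈ P (i + j))
    (h0 : ∀ i, ∀ x ∈ A.piece i, f0 x ∈ P i) (h1 : ∀ i, ∀ x ∈ C.piece i, f1 x ∈ P i) :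
    ⨆ i, P i = ⊤ := by
  rw [eq_top_iff]
  intro z _
  have hz : z ∈ LieSubalgebra.lieSpan K D (Set.range f0 ∪ Set.range f1) := by rw [hgen]; trivial
  induction hz using LieSubalgebra.lieSpan_induction with
  | mem z hz =>
    rcases hz with ⟨x, rfl⟩ | ⟨x, rfl⟩
    · induction x using graded_ind with
      | h0 => simp
      | hadd x y hx hy => rw [map_add]; exact Submodule.add_mem _ (hx trivial) (hy trivial)
      | hom i x hx => exact Submodule.mem_iSup_of_mem i (h0 i x hx)
    · induction x using graded_ind with
      | h0 => simp
      | hadd x y hx hy => rw [map_add]; exact Submodule.add_mem _ (hx trivial) (hy trivial)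
      | hom i x hx => exact Submodule.mem_iSup_of_mem i (h1 i x hx)
  | zero => exact Submodule.zero_mem _
  | add x y _ _ hx hy => exact Submodule.add_mem _ (hx trivial) (hy trivial)
  | smul a x _ hx => exact Submodule.smul_mem _ _ (hx trivial)
  | lie x y _ _ hx hy =>
    refine Submodule.iSup_induction P (motive := fun x => ⁅x, y⁆ ∈ ⨆ i, P i) (hx trivial) ?_ ?_ ?_
    · intro i x hxi
      refine Submodule.iSup_induction P (motive := fun y => ⁅x, y⁆ ∈ ⨆ i, P i) (hy trivial) ?_ ?_ ?_
      · intro j y hyj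
        exact Submodule.mem_iSup_of_mem (i + j) (hP i j x y hxi hyj)
      · simp
      · intro y y' h h'; rw [lie_add]; exact Submodule.add_mem _ h h'
    · simp
    · intro y y' h h'; rw [add_lie]; exact Submodule.add_mem _ h h'

end Grade

end FreeAmalg

/-- the class of all graded Lie algebras over a field `K` is closed
under free amalgamation. -/
theorem gradedLieAlg_free_amalgamation (K : Type u) [Field K]
    (A B C : GradedLieAlg K) (g0 : B →ₗ⁅K⁆ A) (g1 : B →ₗ⁅K⁆ C)
    (hg0 : Function.Injective g0) (hg0' : LieHomIsGraded B A g0)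
    (hg1 : Function.Injective g1) (hg1' : LieHomIsGraded B C g1) :
    ∃ (D : GradedLieAlg K) (f0 : A →ₗ⁅K⁆ D) (f1 : C →ₗ⁅K⁆ D),
      Function.Injective f0 ∧ LieHomIsGraded A D f0 ∧
      Function.Injective f1 ∧ LieHomIsGraded C D f1 ∧
      f0.comp g0 = f1.comp g1 ∧
      Set.range f0 ∩ Set.range f1 = Set.range (f0.comp g0) ∧
      LieSubalgebra.lieSpan K D (Set.range f0 ∪ Set.range f1) = ⊤ ∧
      ∀ (E : GradedLieAlg K) (f : A →ₗ⁅K⁆ E) (g : C →ₗ⁅K⁆ E),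
        LieHomIsGraded A E f → LieHomIsGraded C E g → f.comp g0 = g.comp g1 →
        ∃ h : D →ₗ⁅K⁆ E, LieHomIsGraded D E h ∧ h.comp f0 = f ∧ h.comp f1 = g := by
  classical
  obtain ⟨D, iD, jD, f0, f1, hcomm, hgen, huniv⟩ := FreeAmalg.exists_pushout g0 g1
  have hc : ∀ b, f0 (g0 b) = f1 (g1 b) := fun b => LieHom.congr_fun hcomm b
  obtain ⟨dA, hdA⟩ := FreeAmalg.exists_loop A f0
  obtain ⟨dC, hdC⟩ := FreeAmalg.exists_loop C f1
  have hd : dA.comp g0 = dC.comp g1 := by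
    ext1 b
    simp only [LieHom.comp_apply]
    induction b using FreeAmalg.graded_ind with
    | h0 => rw [map_zero, map_zero, map_zero, map_zero]
    | hadd x y hx hy => rw [map_add, map_add, map_add, map_add, hx, hy]
    | hom i x hx => rw [hdA i _ (hg0' i x hx), hdC i _ (hg1' i x hx), hc]
  obtain ⟨d, hd0, hd1⟩ := huniv (LieAlgebra.loopAlgebra K ℕ D) dA dC hd
  have hd0 : ∀ x, d (f0 x) = dA x := fun x => LieHom.congr_fun hd0 x
  have hd1 : ∀ x, d (f1 x) = dC x := fun x => LieHom.congr_fun hd1 x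
  let Q : ℕ → Submodule K D := fun i => if i = 0 then ⊥ else
    LinearMap.eqLocus (d : D →ₗ[K] LieAlgebra.loopAlgebra K ℕ D) (FreeAmalg.mono K D i)
  have hQ0 : Q 0 = ⊥ := by simp [Q]
  have hQs : ∀ i, i ≠ 0 → ∀ x, x ∈ Q i ↔ d x = FreeAmalg.mono K D i x := by
    intro i hi x
    simp only [Q, if_neg hi]
    exact LinearMap.mem_eqLocus
  have hQd : ∀ i, ∀ x ∈ Q i, d x = FreeAmalg.mono K D i x := by
    intro i x hx
    by_cases hi : i = 0
    · subst hi
      rw [hQ0, Submodule.mem_bot] at hx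
      rw [hx, map_zero, map_zero]
    · exact (hQs i hi x).mp hx
  have hQl : ∀ i j x y, x ∈ Q i → y ∈ Q j → ⁅x, y⁆ ∈ Q (i + j) := by
    intro i j x y hx hy
    by_cases hi : i = 0
    · subst hi
      rw [hQ0, Submodule.mem_bot] at hx
      rw [hx, zero_lie]
      exact Submodule.zero_mem _
    · rw [hQs _ (by omega), LieHom.map_lie, hQd i x hx, hQd j y hy, FreeAmalg.mono_lie]
  have hA : ∀ i, ∀ x ∈ A.piece i, f0 x ∈ Q i := by
    intro i x hx
    by_cases hi : i = 0
    · subst hi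
      rw [A.piece_zero, Submodule.mem_bot] at hx
      rw [hx, map_zero]
      exact Submodule.zero_mem _
    · rw [hQs i hi, hd0, hdA i x hx]
  have hC : ∀ i, ∀ x ∈ C.piece i, f1 x ∈ Q i := by
    intro i x hx
    by_cases hi : i = 0
    · subst hi
      rw [C.piece_zero, Submodule.mem_bot] at hx
      rw [hx, map_zero]
      exact Submodule.zero_mem _
    · rw [hQs i hi, hd1, hdC i x hx]
  have htop : ⨆ i, Q i = ⊤ := FreeAmalg.sup_top f0 f1 hgen Q hQl hA hC
  have hind : iSupIndep Q := by
    rw [iSupIndep_iff_finsetSum_eq_zero_imp_eq_zero]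
    intro s v hv hs
    apply FreeAmalg.mono_sum (K := K)
    have h1 := congrArg d hs
    rw [map_sum, map_zero] at h1
    rw [← h1]
    exact Finset.sum_congr rfl fun i hi => (hQd i _ (hv i hi)).symm
  obtain ⟨M, iM, jM, f, g, hf, hg, hfg, hint⟩ := FreeAmalg.exists_rep' g0 g1 hg0 hg1
  obtain ⟨k, hk0, hk1⟩ := huniv M f g hfg
  have hk0 : ∀ x, k (f0 x) = f x := fun x => LieHom.congr_fun hk0 x
  have hk1 : ∀ x, k (f1 x) = g x := fun x => LieHom.congr_fun hk1 x
  refine ⟨⟨D, Q, DirectSum.isInternal_submodule_of_iSupIndep_of_iSup_eq_top hind htop, hQ0, hQl⟩,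
    f0, f1, ?_, hA, ?_, hC, hcomm, ?_, hgen, ?_⟩
  · intro x y hxy
    apply hf
    rw [← hk0, ← hk0]
    exact congrArg k hxy
  · intro x y hxy
    apply hg
    rw [← hk1, ← hk1]
    exact congrArg k hxy
  · ext z
    constructor
    · rintro ⟨⟨a, rfl⟩, ⟨c, h⟩⟩
      obtain ⟨b, rfl⟩ := hint a c (by rw [← hk0, ← hk1]; exact congrArg k h.symm)
      exact ⟨b, rfl⟩
    · rintro ⟨b, rfl⟩
      exact ⟨⟨g0 b, rfl⟩, ⟨g1 b, (hc b).symm⟩⟩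
  · intro E f g hf hg hfg
    obtain ⟨h, hh0, hh1⟩ := huniv E f g hfg
    refine ⟨h, ?_, hh0, hh1⟩
    have hh0 : ∀ x, h (f0 x) = f x := fun x => LieHom.congr_fun hh0 x
    have hh1 : ∀ x, h (f1 x) = g x := fun x => LieHom.congr_fun hh1 x
    let P : ℕ → Submodule K D := fun i => Q i ⊓ (E.piece i).comap (h : D →ₗ[K] E)
    have hP : ∀ i x, x ∈ P i ↔ x ∈ Q i ∧ h x ∈ E.piece i := fun i x => Iff.rfl
    have hPtop : ⨆ i, P i = ⊤ := by
      refine FreeAmalg.sup_top f0 f1 hgen P ?_ ?_ ?_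
      · intro i j x y hx hy
        rw [hP] at hx hy ⊢
        refine ⟨hQl i j x y hx.1 hy.1, ?_⟩
        rw [LieHom.map_lie]
        exact E.lie_mem i j _ _ hx.2 hy.2
      · intro i x hx
        rw [hP, hh0]
        exact ⟨hA i x hx, hf i x hx⟩
      · intro i x hx
        rw [hP, hh1]
        exact ⟨hC i x hx, hg i x hx⟩
    intro i x hx
    have hx : x ∈ Q i := hx
    have hxt : x ∈ ⨆ i, P i := by rw [hPtop]; trivial
    rw [iSup_split_single P i, Submodule.mem_sup] at hxt
    obtain ⟨y, hy, z, hz, rfl⟩ := hxt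
    have hz1 : z ∈ ⨆ j, ⨆ (_ : j ≠ i), Q j :=
      (iSup₂_mono fun j _ => inf_le_left : (⨆ j, ⨆ (_ : j ≠ i), P j) ≤ _) hz
    have hz2 : z ∈ Q i := by
      have := Submodule.sub_mem _ hx hy.1
      rwa [add_sub_cancel_left] at this
    have hz0 : z = 0 := Submodule.disjoint_def.mp (hind i) z hz2 hz1
    rw [hz0, add_zero]
    exact hy.2
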